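/- The function s_μ is nondecreasing on (0,∞); it is concave, i.e. for all x₁, x₂ ∈ (0,∞) and t ∈ [0,1], s_μ(t x₁ + (1−t) x₂) ≥ t s_μ(x₁) + (1−t) s_μ(x₂) (with the convention that the inequality holds automatically when a right-hand side term is +∞ only if the left-hand side is +∞, i.e. concavity in ℝ ∪ {+∞}); and its slopes are bounded by 1: for all 0 < x₁ ≤ x₂ with s_μ(x₁) finite, s_μ(x₂) − s_μ(x₁) ≤ x₂ − x₁. -/

import Mathlib

open MeasureTheory Filter

namespace MFA

/-- The boundary of the Besov domain of a finite measure `μ` on `[0,T]`: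
`s_μ(1/p) = sup{σ ∈ ℝ | sup_j 2^{jσ} (2^{-j} ∑_{k<2^j} μ(I_{j,k})^p)^{1/p} < ∞}`,
written as a function of `x = 1/p`, with values in `ℝ ∪ {+∞} ⊆ EReal`. -/
noncomputable def besovBoundary (T : ℝ) (μ : Measure ℝ) (x : ℝ) : EReal :=
  sSup (Real.toEReal '' {σ : ℝ | ∃ C : ℝ, ∀ j : ℕ,
    (2 : ℝ) ^ ((j : ℝ) * σ) *
      ((2 : ℝ) ^ (-(j : ℝ)) * ∑ k ∈ Finset.range (2 ^ j),
        (μ (Set.Icc ((k : ℝ) * 2 ^ (-(j : ℝ)) * T) (((k : ℝ) + 1) * 2 ^ (-(j : ℝ)) * T))).toReal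
          ^ (1 / x)) ^ x ≤ C})

/-- The power mean of exponent `1 / x` of the masses of the dyadic intervals of generation `j`. -/
noncomputable def dyadicMean (T : ℝ) (μ : Measure ℝ) (j : ℕ) (x : ℝ) : ℝ :=
  ((2 : ℝ) ^ (-(j : ℝ)) * ∑ k ∈ Finset.range (2 ^ j),
    (μ (Set.Icc ((k : ℝ) * 2 ^ (-(j : ℝ)) * T) (((k : ℝ) + 1) * 2 ^ (-(j : ℝ)) * T))).toReal
      ^ (1 / x)) ^ x

/-- The set of exponents whose supremum is the Besov boundary at `x`. -/
def besovExponents (T : ℝ) (μ : Measure ℝ) (x : ℝ) : Set ℝ :=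
  {σ : ℝ | ∃ C : ℝ, ∀ j : ℕ, (2 : ℝ) ^ ((j : ℝ) * σ) * dyadicMean T μ j x ≤ C}

theorem besovBoundary_eq_sSup (T : ℝ) (μ : Measure ℝ) (x : ℝ) :
    besovBoundary T μ x = sSup (Real.toEReal '' besovExponents T μ x) :=
  rfl

section PowerSums

variable {ι : Type*} (s : Finset ι) {a : ι → ℝ}

theorem powerMean_le_powerMean (ha : ∀ i, 0 ≤ a i) {w x₁ x₂ : ℝ} (hw : 0 ≤ w)
    (hws : (s.card : ℝ) * w = 1) (h₁ : 0 < x₁) (h₁₂ : x₁ ≤ x₂) :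
    (w * ∑ i ∈ s, a i ^ (1 / x₂)) ^ x₂ ≤ (w * ∑ i ∈ s, a i ^ (1 / x₁)) ^ x₁ := by
  have h₂ : 0 < x₂ := h₁.trans_le h₁₂
  have hnn : 0 ≤ w * ∑ i ∈ s, a i ^ (1 / x₂) :=
    mul_nonneg hw (Finset.sum_nonneg fun i _ => Real.rpow_nonneg (ha i) _)
  have hmean := Real.rpow_arith_mean_le_arith_mean_rpow s (fun _ => w) (fun i => a i ^ (1 / x₂))
    (fun _ _ => hw) (by simpa using hws) (fun i _ => Real.rpow_nonneg (ha i) _)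
    ((one_le_div h₁).2 h₁₂)
  have hexp : ∀ i, (a i ^ (1 / x₂)) ^ (x₂ / x₁) = a i ^ (1 / x₁) := fun i => by
    rw [← Real.rpow_mul (ha i)]
    congr 1
    field_simp
  simp only [← Finset.mul_sum, hexp] at hmean
  calc (w * ∑ i ∈ s, a i ^ (1 / x₂)) ^ x₂
      = ((w * ∑ i ∈ s, a i ^ (1 / x₂)) ^ (x₂ / x₁)) ^ x₁ := by
        rw [← Real.rpow_mul hnn, div_mul_cancel₀ _ h₁.ne']
    _ ≤ _ := Real.rpow_le_rpow (Real.rpow_nonneg hnn _) hmean h₁.le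

theorem sum_rpow_le_rpow_sum (ha : ∀ i, 0 ≤ a i) {p : ℝ} (hp : 1 ≤ p) :
    ∑ i ∈ s, a i ^ p ≤ (∑ i ∈ s, a i) ^ p := by
  classical
  induction s using Finset.induction_on with
  | empty => simp [Real.zero_rpow (by linarith : p ≠ 0)]
  | insert i s hi ih =>
    rw [Finset.sum_insert hi, Finset.sum_insert hi]
    exact (add_le_add_right ih _).trans
      (Real.add_rpow_le_rpow_add (ha i) (Finset.sum_nonneg fun k _ => ha k) hp)

theorem rpow_sum_le_rpow_sum (ha : ∀ i, 0 ≤ a i) {x₁ x₂ : ℝ} (h₁ : 0 < x₁) (h₁₂ : x₁ ≤ x₂) :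
    (∑ i ∈ s, a i ^ (1 / x₁)) ^ x₁ ≤ (∑ i ∈ s, a i ^ (1 / x₂)) ^ x₂ := by
  have h₂ : 0 < x₂ := h₁.trans_le h₁₂
  have hnn : ∀ x : ℝ, 0 ≤ ∑ i ∈ s, a i ^ (1 / x) := fun x =>
    Finset.sum_nonneg fun i _ => Real.rpow_nonneg (ha i) _
  have hsum := sum_rpow_le_rpow_sum s (a := fun i => a i ^ (1 / x₂))
    (fun i => Real.rpow_nonneg (ha i) _) ((one_le_div h₁).2 h₁₂)
  have hexp : ∀ i, (a i ^ (1 / x₂)) ^ (x₂ / x₁) = a i ^ (1 / x₁) := fun i => by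
    rw [← Real.rpow_mul (ha i)]
    congr 1
    field_simp
  simp only [hexp] at hsum
  calc (∑ i ∈ s, a i ^ (1 / x₁)) ^ x₁
      ≤ ((∑ i ∈ s, a i ^ (1 / x₂)) ^ (x₂ / x₁)) ^ x₁ := Real.rpow_le_rpow (hnn _) hsum h₁.le
    _ = _ := by rw [← Real.rpow_mul (hnn _), div_mul_cancel₀ _ h₁.ne']

theorem powerMean_interpolation (ha : ∀ i, 0 ≤ a i) {w x₁ x₂ t : ℝ} (hw : 0 ≤ w)
    (h₁ : 0 < x₁) (h₂ : 0 < x₂) (ht : 0 < t) (ht' : t < 1) :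
    (w * ∑ i ∈ s, a i ^ (1 / (t * x₁ + (1 - t) * x₂))) ^ (t * x₁ + (1 - t) * x₂) ≤
      ((w * ∑ i ∈ s, a i ^ (1 / x₁)) ^ x₁) ^ t *
        ((w * ∑ i ∈ s, a i ^ (1 / x₂)) ^ x₂) ^ (1 - t) := by
  have hu : 0 < 1 - t := sub_pos.2 ht'
  have hy₁ : 0 < t * x₁ := mul_pos ht h₁
  have hy₂ : 0 < (1 - t) * x₂ := mul_pos hu h₂
  set x := t * x₁ + (1 - t) * x₂ with hx
  have hx0 : 0 < x := by positivity
  have hnn : ∀ y : ℝ, 0 ≤ w * ∑ i ∈ s, a i ^ (1 / y) := fun y =>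
    mul_nonneg hw (Finset.sum_nonneg fun i _ => Real.rpow_nonneg (ha i) _)
  have hpq : (x / (t * x₁)).HolderConjugate (x / ((1 - t) * x₂)) := by
    rw [Real.holderConjugate_iff]
    refine ⟨(one_lt_div hy₁).2 (by linarith), ?_⟩
    rw [inv_div, inv_div, ← add_div, ← hx, div_self hx0.ne']
  have hterm : ∀ {θ y u : ℝ}, 0 < θ → 0 < y → 0 ≤ u →
      ((w * u ^ (1 / y)) ^ (θ * y / x)) ^ (x / (θ * y)) = w * u ^ (1 / y) := by
    intro θ y u hθ hy hu0
    rw [← Real.rpow_mul (mul_nonneg hw (Real.rpow_nonneg hu0 _)),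
      show θ * y / x * (x / (θ * y)) = 1 by field_simp, Real.rpow_one]
  have hprod : ∀ i, (w * a i ^ (1 / x₁)) ^ (t * x₁ / x) *
      (w * a i ^ (1 / x₂)) ^ ((1 - t) * x₂ / x) = w * a i ^ (1 / x) := by
    intro i
    have hθ : t * x₁ / x + (1 - t) * x₂ / x = 1 := by rw [← add_div, ← hx, div_self hx0.ne']
    rw [Real.mul_rpow hw (Real.rpow_nonneg (ha i) _), Real.mul_rpow hw (Real.rpow_nonneg (ha i) _),
      ← Real.rpow_mul (ha i), ← Real.rpow_mul (ha i), mul_mul_mul_comm,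
      ← Real.rpow_add_of_nonneg hw (by positivity) (by positivity),
      ← Real.rpow_add_of_nonneg (ha i) (by positivity) (by positivity), hθ, Real.rpow_one]
    congr 2
    field_simp
    ring
  have holder := Real.inner_le_Lp_mul_Lq_of_nonneg s hpq
    (f := fun i => (w * a i ^ (1 / x₁)) ^ (t * x₁ / x))
    (g := fun i => (w * a i ^ (1 / x₂)) ^ ((1 - t) * x₂ / x))
    (fun i _ => Real.rpow_nonneg (mul_nonneg hw (Real.rpow_nonneg (ha i) _)) _)
    (fun i _ => Real.rpow_nonneg (mul_nonneg hw (Real.rpow_nonneg (ha i) _)) _)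
  simp only [hprod, hterm ht h₁ (ha _), hterm hu h₂ (ha _), ← Finset.mul_sum, one_div_div]
    at holder
  refine (Real.rpow_le_rpow (hnn _) holder hx0.le).trans_eq ?_
  rw [Real.mul_rpow (Real.rpow_nonneg (hnn _) _) (Real.rpow_nonneg (hnn _) _),
    ← Real.rpow_mul (hnn _), ← Real.rpow_mul (hnn _), ← Real.rpow_mul (hnn _),
    ← Real.rpow_mul (hnn _), div_mul_cancel₀ _ hx0.ne', div_mul_cancel₀ _ hx0.ne',
    mul_comm t, mul_comm (1 - t)]

end PowerSums

section Besov

variable (T : ℝ) (μ : Measure ℝ)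

theorem dyadicMean_nonneg (j : ℕ) (x : ℝ) : 0 ≤ dyadicMean T μ j x := by
  unfold dyadicMean
  positivity

theorem dyadicMean_antitone (j : ℕ) {x₁ x₂ : ℝ} (h₁ : 0 < x₁) (h₁₂ : x₁ ≤ x₂) :
    dyadicMean T μ j x₂ ≤ dyadicMean T μ j x₁ := by
  refine powerMean_le_powerMean _ (fun _ => ENNReal.toReal_nonneg) (by positivity) ?_ h₁ h₁₂
  rw [Finset.card_range, Nat.cast_pow, Nat.cast_ofNat, ← Real.rpow_natCast,
    ← Real.rpow_add two_pos, add_neg_cancel, Real.rpow_zero]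

theorem dyadicMean_interpolation (j : ℕ) {x₁ x₂ t : ℝ} (h₁ : 0 < x₁) (h₂ : 0 < x₂)
    (ht : 0 < t) (ht' : t < 1) :
    dyadicMean T μ j (t * x₁ + (1 - t) * x₂) ≤
      dyadicMean T μ j x₁ ^ t * dyadicMean T μ j x₂ ^ (1 - t) :=
  powerMean_interpolation _ (fun _ => ENNReal.toReal_nonneg) (by positivity) h₁ h₂ ht ht'

theorem dyadicMean_le_two_rpow_mul (j : ℕ) {x₁ x₂ : ℝ} (h₁ : 0 < x₁) (h₁₂ : x₁ ≤ x₂) :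
    dyadicMean T μ j x₁ ≤ 2 ^ ((j : ℝ) * (x₂ - x₁)) * dyadicMean T μ j x₂ := by
  unfold dyadicMean
  rw [Real.mul_rpow (by positivity) (by positivity), Real.mul_rpow (by positivity) (by positivity),
    ← Real.rpow_mul two_pos.le, ← Real.rpow_mul two_pos.le, ← mul_assoc, ← Real.rpow_add two_pos,
    show (j : ℝ) * (x₂ - x₁) + -(j : ℝ) * x₂ = -(j : ℝ) * x₁ by ring]
  exact mul_le_mul_of_nonneg_left
    (rpow_sum_le_rpow_sum _ (fun _ => ENNReal.toReal_nonneg) h₁ h₁₂) (by positivity)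

theorem besovExponents_mono {x₁ x₂ : ℝ} (h₁ : 0 < x₁) (h₁₂ : x₁ ≤ x₂) :
    besovExponents T μ x₁ ⊆ besovExponents T μ x₂ := by
  rintro σ ⟨C, hC⟩
  exact ⟨C, fun j => (mul_le_mul_of_nonneg_left (dyadicMean_antitone T μ j h₁ h₁₂)
    (by positivity)).trans (hC j)⟩

theorem convexComb_mem_besovExponents {x₁ x₂ t σ₁ σ₂ : ℝ} (h₁ : 0 < x₁) (h₂ : 0 < x₂)
    (ht : 0 < t) (ht' : t < 1) (hσ₁ : σ₁ ∈ besovExponents T μ x₁)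
    (hσ₂ : σ₂ ∈ besovExponents T μ x₂) :
    t * σ₁ + (1 - t) * σ₂ ∈ besovExponents T μ (t * x₁ + (1 - t) * x₂) := by
  obtain ⟨C₁, hC₁⟩ := hσ₁
  obtain ⟨C₂, hC₂⟩ := hσ₂
  have hu : 0 < 1 - t := sub_pos.2 ht'
  have hnn : ∀ (j : ℕ) (σ x : ℝ), 0 ≤ (2 : ℝ) ^ ((j : ℝ) * σ) * dyadicMean T μ j x :=
    fun j σ x => mul_nonneg (by positivity) (dyadicMean_nonneg T μ j x)
  refine ⟨C₁ ^ t * C₂ ^ (1 - t), fun j => ?_⟩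
  calc (2 : ℝ) ^ ((j : ℝ) * (t * σ₁ + (1 - t) * σ₂)) * dyadicMean T μ j (t * x₁ + (1 - t) * x₂)
      ≤ 2 ^ ((j : ℝ) * (t * σ₁ + (1 - t) * σ₂)) *
          (dyadicMean T μ j x₁ ^ t * dyadicMean T μ j x₂ ^ (1 - t)) :=
        mul_le_mul_of_nonneg_left (dyadicMean_interpolation T μ j h₁ h₂ ht ht') (by positivity)
    _ = (2 ^ ((j : ℝ) * σ₁) * dyadicMean T μ j x₁) ^ t *
          (2 ^ ((j : ℝ) * σ₂) * dyadicMean T μ j x₂) ^ (1 - t) := by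
        rw [Real.mul_rpow (by positivity) (dyadicMean_nonneg T μ j x₁),
          Real.mul_rpow (by positivity) (dyadicMean_nonneg T μ j x₂),
          ← Real.rpow_mul two_pos.le, ← Real.rpow_mul two_pos.le, mul_mul_mul_comm,
          ← Real.rpow_add two_pos]
        ring_nf
    _ ≤ C₁ ^ t * C₂ ^ (1 - t) :=
        mul_le_mul (Real.rpow_le_rpow (hnn _ _ _) (hC₁ j) ht.le)
          (Real.rpow_le_rpow (hnn _ _ _) (hC₂ j) hu.le) (Real.rpow_nonneg (hnn _ _ _) _)
          (Real.rpow_nonneg ((hnn _ _ _).trans (hC₁ j)) _)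

theorem sub_mem_besovExponents {x₁ x₂ σ : ℝ} (h₁ : 0 < x₁) (h₁₂ : x₁ ≤ x₂)
    (hσ : σ ∈ besovExponents T μ x₂) : σ - (x₂ - x₁) ∈ besovExponents T μ x₁ := by
  obtain ⟨C, hC⟩ := hσ
  refine ⟨C, fun j => le_trans ?_ (hC j)⟩
  refine (mul_le_mul_of_nonneg_left (dyadicMean_le_two_rpow_mul T μ j h₁ h₁₂)
    (by positivity)).trans_eq ?_
  rw [← mul_assoc, ← Real.rpow_add two_pos]
  ring_nf

theorem exists_mem_of_lt_mul_besovBoundary {x t : ℝ} (ht : 0 < t) {b : EReal}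
    (hb : b < t * besovBoundary T μ x) : ∃ σ ∈ besovExponents T μ x, b ≤ ((t * σ : ℝ) : EReal) := by
  have ht' : (0 : EReal) < t := EReal.coe_pos.2 ht
  rw [mul_comm, ← EReal.div_lt_iff ht' (EReal.coe_ne_top t), besovBoundary_eq_sSup,
    lt_sSup_iff] at hb
  obtain ⟨_, ⟨σ, hσ, rfl⟩, hlt⟩ := hb
  rw [EReal.div_lt_iff ht' (EReal.coe_ne_top t), mul_comm, ← EReal.coe_mul] at hlt
  exact ⟨σ, hσ, hlt.le⟩

end Besov

/-- **Properties of the Besov boundary** (Proposition `P:prop_s`): `s_μ` is nondecreasing,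
concave (in `ℝ ∪ {+∞}`), and has slopes bounded by `1`. -/
theorem besovBoundary_monotone_concave_slope_le_one
    (T : ℝ) (hT : 0 < T) (μ : Measure ℝ) [IsFiniteMeasure μ] :
    (∀ x₁ x₂ : ℝ, 0 < x₁ → x₁ ≤ x₂ → besovBoundary T μ x₁ ≤ besovBoundary T μ x₂) ∧
    (∀ x₁ x₂ t : ℝ, 0 < x₁ → 0 < x₂ → 0 ≤ t → t ≤ 1 →
      (t : EReal) * besovBoundary T μ x₁ + ((1 - t : ℝ) : EReal) * besovBoundary T μ x₂ ≤
        besovBoundary T μ (t * x₁ + (1 - t) * x₂)) ∧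
    (∀ x₁ x₂ : ℝ, 0 < x₁ → x₁ ≤ x₂ → ∀ a : ℝ, besovBoundary T μ x₁ = (a : EReal) →
      besovBoundary T μ x₂ ≤ besovBoundary T μ x₁ + ((x₂ - x₁ : ℝ) : EReal)) := by
  refine ⟨fun x₁ x₂ h₁ h₁₂ => sSup_le_sSup (Set.image_mono (besovExponents_mono T μ h₁ h₁₂)),
    fun x₁ x₂ t h₁ h₂ ht ht' => ?_, fun x₁ x₂ h₁ h₁₂ a _ => ?_⟩
  · obtain rfl | ht := ht.eq_or_lt
    · simp
    obtain rfl | ht' := ht'.eq_or_lt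
    · simp
    refine EReal.add_le_of_forall_lt fun b hb c hc => ?_
    obtain ⟨σ₁, hσ₁, hb⟩ := exists_mem_of_lt_mul_besovBoundary T μ ht hb
    obtain ⟨σ₂, hσ₂, hc⟩ := exists_mem_of_lt_mul_besovBoundary T μ (sub_pos.2 ht') hc
    refine (add_le_add hb hc).trans ?_
    rw [← EReal.coe_add]
    exact le_sSup (Set.mem_image_of_mem _
      (convexComb_mem_besovExponents T μ h₁ h₂ ht ht' hσ₁ hσ₂))
  · rw [besovBoundary_eq_sSup T μ x₂]
    refine sSup_le ?_
    rintro _ ⟨σ, hσ, rfl⟩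
    rw [show σ = σ - (x₂ - x₁) + (x₂ - x₁) by ring, EReal.coe_add]
    exact add_le_add_left
      (le_sSup (Set.mem_image_of_mem _ (sub_mem_besovExponents T μ h₁ h₁₂ hσ))) _

end MFA
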